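/- Fix an integer g ≥ 2. For each m ≥ 1 let B′_m ⊆ ℤΣ_m be the subgroup generated by the permutations σ ∈ Σ_m with S_1(σ) ≥ m − g. Then ∂ maps B′_{m+1} into B′_m, and for every m with 2 ≤ m ≤ g the resulting sequence B′_{m+1} → B′_m → B′_{m−1} is exact at B′_m: every element of B′_m killed by ∂ lies in ∂(B′_{m+1}). (This is the combinatorial form, via the permutation map P, of Harer's split-exactness of C_{p+1}(F;1)/Γ(F) → C_p(F;1)/Γ(F) → C_{p−1}(F;1)/Γ(F) for 1 ≤ p ≤ g−1, where F is a surface of genus g with boundary.) -/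

import Mathlib

open Equiv

/-- The `j`-th face of a permutation of `Fin (n+1)`: delete the entry `σ j` from the
one-line notation and decrease by one every remaining entry exceeding `σ j`. -/
def permFace {n : ℕ} (σ : Equiv.Perm (Fin (n + 1))) (j : Fin (n + 1)) :
    Equiv.Perm (Fin n) :=
  (finSuccAboveEquiv j).trans
    ((σ.subtypeEquiv (fun a => (σ.injective.ne_iff (x := a) (y := j)).symm)).trans
      (finSuccAboveEquiv (σ j)).symm)

/-- The hat `σ̂ ∈ Σ_{n+1}` of `σ ∈ Σ_n`: `σ̂ 0 = 0` and `σ̂ (j+1) = σ j + 1`. -/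
def permHat {n : ℕ} (σ : Equiv.Perm (Fin n)) : Equiv.Perm (Fin (n + 1)) :=
  (finSuccEquiv n).symm.permCongr σ.optionCongr

/-- The alternating-sum boundary map `∂ : ℤΣ_{n+1} → ℤΣ_n`. -/
def permBdry (n : ℕ) :
    FreeAbelianGroup (Equiv.Perm (Fin (n + 1))) →+ FreeAbelianGroup (Equiv.Perm (Fin n)) :=
  FreeAbelianGroup.lift fun σ =>
    ∑ j : Fin (n + 1), (-1 : ℤ) ^ (j : ℕ) • FreeAbelianGroup.of (permFace σ j)

/-- The linear extension `D : ℤΣ_n → ℤΣ_{n+1}` of the hat operation. -/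
def permHatMap (n : ℕ) :
    FreeAbelianGroup (Equiv.Perm (Fin n)) →+ FreeAbelianGroup (Equiv.Perm (Fin (n + 1))) :=
  FreeAbelianGroup.lift fun σ => FreeAbelianGroup.of (permHat σ)

/-- The number of orbits (cycles, counting fixed points) of a permutation of `Fin m`. -/
def permCyc {m : ℕ} (π : Equiv.Perm (Fin m)) : ℕ :=
  π.cycleType.card + (Finset.univ.filter fun x => π x = x).card

/-- The genus `S_2(σ) = (m − Cyc(c_m σ⁻¹ c_m⁻¹ σ))/2` of `σ ∈ Σ_m`. -/
def permS2 {m : ℕ} (σ : Equiv.Perm (Fin m)) : ℕ :=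
  (m - permCyc (finRotate m * σ⁻¹ * (finRotate m)⁻¹ * σ)) / 2

/-- The genus `S_1(σ) = ((m+1) − Cyc(c_{m+1} σ̂⁻¹ c_{m+1}⁻¹ σ̂))/2` of `σ ∈ Σ_m`. -/
def permS1 {m : ℕ} (σ : Equiv.Perm (Fin m)) : ℕ :=
  ((m + 1) -
    permCyc (finRotate (m + 1) * (permHat σ)⁻¹ * (finRotate (m + 1))⁻¹ * permHat σ)) / 2

/-- The subgroup `B′_m ⊆ ℤΣ_m` generated by the permutations `σ` with `S_1 σ ≥ m − g`. -/
def genusSubgroup1 (g m : ℕ) : AddSubgroup (FreeAbelianGroup (Equiv.Perm (Fin m))) :=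
  AddSubgroup.closure
    (FreeAbelianGroup.of '' {σ : Equiv.Perm (Fin m) | (m : ℤ) - g ≤ (permS1 σ : ℤ)})

theorem permFace_spec {n : ℕ} (σ : Equiv.Perm (Fin (n + 1))) (j : Fin (n + 1)) (x : Fin n) :
    σ (j.succAbove x) = (σ j).succAbove (permFace σ j x) := by
  have h := (finSuccAboveEquiv (σ j)).apply_symm_apply
    ((σ.subtypeEquiv (fun a => (σ.injective.ne_iff (x := a) (y := j)).symm))
      (finSuccAboveEquiv j x))
  have h' := congrArg Subtype.val h
  exact h'.symm

theorem permFace_eq_of_forall {n : ℕ} {σ : Equiv.Perm (Fin (n + 1))} {j : Fin (n + 1)}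
    {ρ : Equiv.Perm (Fin n)} (h : ∀ x, σ (j.succAbove x) = (σ j).succAbove (ρ x)) :
    permFace σ j = ρ := by
  ext1 x
  exact Fin.succAbove_right_injective ((permFace_spec σ j x).symm.trans (h x))

@[simp] theorem permHat_zero {n : ℕ} (σ : Equiv.Perm (Fin n)) : permHat σ 0 = 0 := by
  simp [permHat]

@[simp] theorem permHat_succ {n : ℕ} (σ : Equiv.Perm (Fin n)) (x : Fin n) :
    permHat σ x.succ = (σ x).succ := by
  simp [permHat]

theorem permFace_permHat_succ {n : ℕ} (σ : Equiv.Perm (Fin (n + 1))) (j : Fin (n + 1)) :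
    permFace (permHat σ) j.succ = permHat (permFace σ j) := by
  refine permFace_eq_of_forall fun x => ?_
  cases x using Fin.cases with
  | zero => simp
  | succ x => simp [permFace_spec]

/-- The permutation of `Fin (n + 1)` with one-line notation `[n σ(0) … σ(n-1)]`. -/
def permTop {n : ℕ} (σ : Equiv.Perm (Fin n)) : Equiv.Perm (Fin (n + 1)) :=
  (finSuccEquiv n).trans (σ.optionCongr.trans (finSuccEquivLast (n := n)).symm)

@[simp] theorem permTop_zero {n : ℕ} (σ : Equiv.Perm (Fin n)) : permTop σ 0 = Fin.last n := by
  simp [permTop]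

@[simp] theorem permTop_succ {n : ℕ} (σ : Equiv.Perm (Fin n)) (x : Fin n) :
    permTop σ x.succ = (σ x).castSucc := by
  simp [permTop]

theorem permFace_permTop_zero {n : ℕ} (σ : Equiv.Perm (Fin n)) : permFace (permTop σ) 0 = σ :=
  permFace_eq_of_forall fun x => by simp

theorem permFace_permTop_succ {n : ℕ} (σ : Equiv.Perm (Fin (n + 1))) (j : Fin (n + 1)) :
    permFace (permTop σ) j.succ = permTop (permFace σ j) := by
  refine permFace_eq_of_forall fun x => ?_
  cases x using Fin.cases with
  | zero => simp
  | succ x => simp [permFace_spec]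

/-- The linear extension of `permTop`. -/
def permTopMap (n : ℕ) :
    FreeAbelianGroup (Equiv.Perm (Fin n)) →+ FreeAbelianGroup (Equiv.Perm (Fin (n + 1))) :=
  FreeAbelianGroup.map permTop

theorem permBdry_permTopMap (n : ℕ) (x : FreeAbelianGroup (Equiv.Perm (Fin (n + 1)))) :
    permBdry (n + 1) (permTopMap (n + 1) x) = x - permTopMap n (permBdry n x) := by
  suffices h : (permBdry (n + 1)).comp (permTopMap (n + 1)) =
      AddMonoidHom.id _ - (permTopMap n).comp (permBdry n) from DFunLike.congr_fun h x
  ext σ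
  simp only [AddMonoidHom.comp_apply, AddMonoidHom.sub_apply, AddMonoidHom.id_apply, permTopMap,
    permBdry, FreeAbelianGroup.map_of_apply, FreeAbelianGroup.lift_apply_of, map_sum, map_zsmul]
  rw [Fin.sum_univ_succ]
  simp [permFace_permTop_zero, permFace_permTop_succ, pow_succ, sub_eq_add_neg]

theorem permCyc_eq_card_quotient {n : ℕ} (π : Equiv.Perm (Fin n)) :
    permCyc π = Nat.card (Quotient (Equiv.Perm.SameCycle.setoid π)) := by
  classical
  let φ : Fin n → Equiv.Perm (Fin n) ⊕ Fin n :=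
    fun x => if π x = x then Sum.inr x else Sum.inl (π.cycleOf x)
  have hker : Equiv.Perm.SameCycle.setoid π = Setoid.ker φ := by
    ext x y
    change π.SameCycle x y ↔ φ x = φ y
    constructor
    · intro h
      simp only [φ, h.apply_eq_self_iff, h.cycleOf_eq]
      split_ifs with hy
      · rw [h.symm.eq_of_left hy]
      · rfl
    · intro h
      simp only [φ] at h
      split_ifs at h with hx hy hy
      · rw [Sum.inr_injective h]
      · exact (Equiv.Perm.sameCycle_iff_cycleOf_eq_of_mem_support
          (Equiv.Perm.mem_support.2 hx) (Equiv.Perm.mem_support.2 hy)).2 (Sum.inl_injective h)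
  have himg : Finset.univ.image φ =
      π.cycleFactorsFinset.disjSum (Finset.univ.filter fun x => π x = x) := by
    ext s
    simp only [Finset.mem_image, Finset.mem_univ, true_and, φ]
    cases s with
    | inl c =>
      rw [Finset.inl_mem_disjSum]
      constructor
      · rintro ⟨x, hx⟩
        split_ifs at hx with h
        rw [← Sum.inl_injective hx]
        exact Equiv.Perm.cycleOf_mem_cycleFactorsFinset_iff.2 (Equiv.Perm.mem_support.2 h)
      · intro hc
        obtain ⟨x, hx⟩ := (Equiv.Perm.mem_cycleFactorsFinset_iff.1 hc).1.nonempty_support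
        have hπ : π x ≠ x := Equiv.Perm.mem_support.1
          (Equiv.Perm.mem_cycleFactorsFinset_support_le hc hx)
        exact ⟨x, by rw [if_neg hπ, Equiv.Perm.cycle_is_cycleOf hx hc]⟩
    | inr x =>
      rw [Finset.inr_mem_disjSum, Finset.mem_filter]
      constructor
      · rintro ⟨y, hy⟩
        split_ifs at hy with h
        exact ⟨Finset.mem_univ _, Sum.inr_injective hy ▸ h⟩
      · rintro ⟨-, h⟩
        exact ⟨x, if_pos h⟩
  have hrange : Set.range φ = (Finset.univ.image φ : Finset _) := by simp
  rw [hker, Nat.card_congr (Setoid.quotientKerEquivRange φ), hrange, himg, permCyc,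
    Equiv.Perm.cycleType_def, Multiset.card_map]
  simp

theorem permCyc_swap_mul_le {n : ℕ} (x y : Fin n) (π : Equiv.Perm (Fin n)) :
    permCyc (Equiv.swap x y * π) ≤ permCyc π + 1 := by
  classical
  set ρ := Equiv.swap x y * π with hρ
  have key : ∀ z, ¬ ρ.SameCycle x z → ¬ ρ.SameCycle y z → ∀ w, π.SameCycle z w →
      ρ.SameCycle z w := by
    intro z hx hy w hw
    obtain ⟨k, -, rfl⟩ := hw.exists_pow_eq'
    have : ∀ k : ℕ, (π ^ k) z = (ρ ^ k) z := by
      intro k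
      induction k with
      | zero => rfl
      | succ k ih =>
        have h1 : (ρ ^ (k + 1)) z ≠ x := fun h => hx (h ▸ Equiv.Perm.SameCycle.symm ⟨k + 1, rfl⟩)
        have h2 : (ρ ^ (k + 1)) z ≠ y := fun h => hy (h ▸ Equiv.Perm.SameCycle.symm ⟨k + 1, rfl⟩)
        have h3 : π = Equiv.swap x y * ρ := by simp [hρ, ← mul_assoc]
        rw [pow_succ', Equiv.Perm.mul_apply, ih, h3, Equiv.Perm.mul_apply,
          ← Equiv.Perm.mul_apply ρ, ← pow_succ', Equiv.swap_apply_of_ne_of_ne h1 h2]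
    rw [this]
    exact ⟨k, rfl⟩
  rw [permCyc_eq_card_quotient, permCyc_eq_card_quotient, ← Finite.card_option]
  let f : Quotient (Equiv.Perm.SameCycle.setoid ρ) →
      Option (Quotient (Equiv.Perm.SameCycle.setoid π)) := fun q =>
    if q = ⟦y⟧ then none else if q = ⟦x⟧ then some ⟦x⟧ else some ⟦q.out⟧
  refine Nat.card_le_card_of_injective f fun p q hpq => ?_
  have hout : ∀ q : Quotient (Equiv.Perm.SameCycle.setoid ρ), ∀ z, q ≠ ⟦z⟧ →
      ¬ ρ.SameCycle z q.out := fun q z h hz =>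
    h (q.out_eq.symm.trans (Quotient.sound (s := Equiv.Perm.SameCycle.setoid ρ) hz.symm))
  have hmk : ∀ q : Quotient (Equiv.Perm.SameCycle.setoid ρ), ∀ z, ρ.SameCycle q.out z → q = ⟦z⟧ :=
    fun q z h => q.out_eq.symm.trans (Quotient.sound (s := Equiv.Perm.SameCycle.setoid ρ) h)
  simp only [f] at hpq
  split_ifs at hpq with h1 h2 _ h4 h5 h6 h7 h8
  · rw [h1, h2]
  · rw [h4, h6]
  · have h := Quotient.exact (s := Equiv.Perm.SameCycle.setoid π) (Option.some_injective _ hpq)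
    exact absurd (key _ (hout q x h6) (hout q y h5) x h.symm) fun h' => h6 (hmk q x h')
  · have h := Quotient.exact (s := Equiv.Perm.SameCycle.setoid π) (Option.some_injective _ hpq)
    exact absurd (key _ (hout p x h4) (hout p y h1) x h) fun h' => h4 (hmk p x h')
  · have h := Quotient.exact (s := Equiv.Perm.SameCycle.setoid π) (Option.some_injective _ hpq)
    rw [hmk p _ (key _ (hout p x h4) (hout p y h1) _ h), Quotient.out_eq]

theorem permCyc_mul_swap_le {n : ℕ} (x y : Fin n) (π : Equiv.Perm (Fin n)) :
    permCyc (π * Equiv.swap x y) ≤ permCyc π + 1 := by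
  rw [Equiv.mul_swap_eq_swap_mul]
  exact permCyc_swap_mul_le _ _ π

theorem permCyc_add_card_support {n : ℕ} (π : Equiv.Perm (Fin n)) :
    permCyc π + π.support.card = π.cycleType.card + n := by
  have h := Finset.card_filter_add_card_filter_not (s := (Finset.univ : Finset (Fin n)))
    (fun x => π x = x)
  simp only [Finset.card_univ, Fintype.card_fin] at h
  have h' : π.support = Finset.univ.filter fun x => ¬ π x = x := by ext; simp
  rw [permCyc, h']
  omega

theorem permCyc_eq_succ_of_succAbove {n : ℕ} {ρ : Equiv.Perm (Fin (n + 1))}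
    {π : Equiv.Perm (Fin n)} {a : Fin (n + 1)} (ha : ρ a = a)
    (h : ∀ x, ρ (a.succAbove x) = a.succAbove (π x)) : permCyc ρ = permCyc π + 1 := by
  have hρ : ρ = π.extendDomain (finSuccAboveEquiv a) := by
    ext1 x
    by_cases hx : x = a
    · subst hx
      rw [ha, Equiv.Perm.extendDomain_apply_not_subtype]
      simp
    · obtain ⟨x, rfl⟩ := Fin.exists_succAbove_eq hx
      rw [h]
      exact (Equiv.Perm.extendDomain_apply_image π (finSuccAboveEquiv a) x).symm
  have h1 := permCyc_add_card_support ρ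
  have h2 := permCyc_add_card_support π
  rw [hρ, Equiv.Perm.cycleType_extendDomain, Equiv.Perm.card_support_extend_domain, ← hρ] at h1
  omega

/-- The cyclic permutation of `Fin n` with the point `b` skipped and fixed. -/
def rotateSkip {n : ℕ} (b : Fin n) : Equiv.Perm (Fin n) :=
  Equiv.swap b (finRotate n b) * finRotate n

theorem rotateSkip_self {n : ℕ} (b : Fin n) : rotateSkip b b = b := by
  simp [rotateSkip]

theorem rotateSkip_succAbove {n : ℕ} (b : Fin (n + 1)) (x : Fin n) :
    rotateSkip b (b.succAbove x) = b.succAbove (finRotate n x) := by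
  obtain _ | n := n
  · exact x.elim0
  have hval : ∀ (m : ℕ) (y : Fin (m + 1)),
      (finRotate (m + 1) y : ℕ) = if (y : ℕ) = m then 0 else (y : ℕ) + 1 := fun m y => by
    rw [coe_finRotate]
    simp [Fin.ext_iff]
  have hne : finRotate _ (b.succAbove x) ≠ finRotate _ b := fun h =>
    Fin.succAbove_ne b x ((finRotate _).injective h)
  have hx := x.isLt
  have hb := b.isLt
  simp only [rotateSkip, Equiv.Perm.mul_apply, Equiv.swap_apply_def, if_neg hne]
  simp only [Fin.ext_iff, apply_ite Fin.val, hval, Fin.succAbove, Fin.lt_def, Fin.val_castSucc,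
    Fin.val_succ]
  split_ifs <;> omega

theorem rotateSkip_inv_succAbove {n : ℕ} (b : Fin (n + 1)) (x : Fin n) :
    (rotateSkip b)⁻¹ (b.succAbove x) = b.succAbove ((finRotate n)⁻¹ x) := by
  rw [Equiv.Perm.inv_eq_iff_eq, rotateSkip_succAbove]
  exact congrArg _ ((finRotate n).apply_symm_apply x).symm

/-- The commutator `c τ⁻¹ c⁻¹ τ` of `τ` with the cyclic permutation `c`. -/
abbrev rotateComm {n : ℕ} (τ : Equiv.Perm (Fin n)) : Equiv.Perm (Fin n) :=
  finRotate n * τ⁻¹ * (finRotate n)⁻¹ * τ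

theorem permCyc_rotateComm_permFace_le {n : ℕ} (τ : Equiv.Perm (Fin (n + 1))) (a : Fin (n + 1)) :
    permCyc (rotateComm (permFace τ a)) ≤ permCyc (rotateComm τ) + 1 := by
  have hlift : permCyc (rotateSkip a * τ⁻¹ * (rotateSkip (τ a))⁻¹ * τ) =
      permCyc (rotateComm (permFace τ a)) + 1 := by
    refine permCyc_eq_succ_of_succAbove (a := a) ?_ fun x => ?_
    · have h : (rotateSkip (τ a))⁻¹ (τ a) = τ a := by
        rw [Equiv.Perm.inv_eq_iff_eq, rotateSkip_self]
      rw [Equiv.Perm.mul_apply, Equiv.Perm.mul_apply, Equiv.Perm.mul_apply, h]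
      exact (congrArg _ (τ.symm_apply_apply a)).trans (rotateSkip_self a)
    · have hinv : ∀ y, τ⁻¹ ((τ a).succAbove y) = a.succAbove ((permFace τ a)⁻¹ y) := fun y => by
        rw [Equiv.Perm.inv_eq_iff_eq, permFace_spec]
        exact congrArg _ ((permFace τ a).apply_symm_apply y).symm
      simp only [rotateComm, Equiv.Perm.mul_apply]
      rw [permFace_spec, rotateSkip_inv_succAbove, hinv, rotateSkip_succAbove]
  have hswap : rotateSkip a * τ⁻¹ * (rotateSkip (τ a))⁻¹ * τ =
      Equiv.swap a (finRotate _ a) * (rotateComm τ *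
        Equiv.swap (τ⁻¹ (τ a)) (τ⁻¹ (finRotate _ (τ a)))) := by
    rw [Equiv.swap_apply_apply]
    simp [rotateSkip, rotateComm, mul_assoc]
  have h1 := permCyc_swap_mul_le a (finRotate _ a) (rotateComm τ *
        Equiv.swap (τ⁻¹ (τ a)) (τ⁻¹ (finRotate _ (τ a))))
  have h2 := permCyc_mul_swap_le (τ⁻¹ (τ a)) (τ⁻¹ (finRotate _ (τ a))) (rotateComm τ)
  rw [← hswap] at h1
  omega

theorem permS1_eq {m : ℕ} (σ : Equiv.Perm (Fin m)) :
    permS1 σ = (m + 1 - permCyc (rotateComm (permHat σ))) / 2 :=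
  rfl

theorem permS1_le_permS1_permFace {m : ℕ} (σ : Equiv.Perm (Fin (m + 1))) (j : Fin (m + 1)) :
    permS1 σ ≤ permS1 (permFace σ j) + 1 := by
  have h := permCyc_rotateComm_permFace_le (permHat σ) j.succ
  rw [permFace_permHat_succ] at h
  rw [permS1_eq, permS1_eq]
  omega

theorem permBdry_mem_genusSubgroup1 (g m : ℕ) {x : FreeAbelianGroup (Equiv.Perm (Fin (m + 1)))}
    (hx : x ∈ genusSubgroup1 g (m + 1)) : permBdry m x ∈ genusSubgroup1 g m := by
  suffices h : genusSubgroup1 g (m + 1) ≤ (genusSubgroup1 g m).comap (permBdry m) from h hx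
  refine (AddSubgroup.closure_le _).2 ?_
  rintro _ ⟨σ, hσ, rfl⟩
  simp only [SetLike.mem_coe, AddSubgroup.mem_comap, permBdry, FreeAbelianGroup.lift_apply_of]
  refine AddSubgroup.sum_mem _ fun j _ => AddSubgroup.zsmul_mem _ ?_ _
  refine AddSubgroup.subset_closure ⟨_, ?_, rfl⟩
  have := permS1_le_permS1_permFace σ j
  simp only [Set.mem_ofPred_eq] at hσ ⊢
  push_cast at hσ
  omega

theorem sign_rotateComm {n : ℕ} (τ : Equiv.Perm (Fin n)) :
    Equiv.Perm.sign (rotateComm τ) = 1 := by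
  simp only [rotateComm, map_mul, map_inv]
  rw [mul_right_comm, inv_mul_cancel_right, mul_inv_cancel]

theorem permCyc_add_two_le {n : ℕ} {π : Equiv.Perm (Fin n)} (hs : Equiv.Perm.sign π = 1)
    (h1 : π ≠ 1) : permCyc π + 2 ≤ n := by
  have h := permCyc_add_card_support π
  have hsum := π.sum_cycleType
  have hsign := Equiv.Perm.sign_of_cycleType π
  rw [hs, hsum] at hsign
  have heven : Even (π.support.card + π.cycleType.card) := by
    rw [← neg_one_pow_eq_one_iff_even (R := ℤˣ) (by decide), ← hsign]
  have hle : π.cycleType.card * 2 ≤ π.support.card := by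
    rw [← hsum, ← smul_eq_mul]
    exact Multiset.card_nsmul_le_sum fun x hx => Equiv.Perm.two_le_of_mem_cycleType hx
  have hpos : 0 < π.cycleType.card := by
    rw [Nat.pos_iff_ne_zero]
    simpa using h1
  obtain ⟨r, hr⟩ := heven
  omega

theorem one_le_permS1 {n : ℕ} {σ : Equiv.Perm (Fin (n + 1))} (h0 : σ 0 ≠ 0) : 1 ≤ permS1 σ := by
  have hne : rotateComm (permHat σ) ≠ 1 := by
    intro h
    have hc : permHat σ * finRotate (n + 2) = finRotate (n + 2) * permHat σ := by
      rwa [rotateComm, mul_eq_one_iff_eq_inv, mul_inv_eq_iff_eq_mul, eq_inv_mul_iff_mul_eq,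
        ← mul_assoc, mul_inv_eq_iff_eq_mul] at h
    have h1 := DFunLike.congr_fun hc 0
    have h2 : finRotate (n + 2) 0 = Fin.succ 0 := by simp
    rw [Equiv.Perm.mul_apply, Equiv.Perm.mul_apply, permHat_zero, h2, permHat_succ] at h1
    exact h0 (Fin.succ_injective _ h1)
  have := permCyc_add_two_le (sign_rotateComm (permHat σ)) hne
  rw [permS1_eq]
  omega

theorem permTopMap_mem_genusSubgroup1 {g n : ℕ} (hn : n + 1 ≤ g)
    (x : FreeAbelianGroup (Equiv.Perm (Fin (n + 1)))) :
    permTopMap (n + 1) x ∈ genusSubgroup1 g (n + 2) := by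
  induction x using FreeAbelianGroup.induction_on with
  | zero => simp
  | of σ =>
    refine AddSubgroup.subset_closure ⟨permTop σ, ?_, rfl⟩
    have := one_le_permS1 (σ := permTop σ) (by simp)
    simp only [Set.mem_ofPred_eq]
    push_cast
    omega
  | neg σ h => simpa using h
  | add x y hx hy => simpa using AddSubgroup.add_mem _ hx hy

/-- Fix `g ≥ 2`. Then `∂` maps `B′_{m+1}` into `B′_m` (for `m ≥ 1`), and for
every `2 ≤ m ≤ g` (here `m = k + 2`) the sequence `B′_{m+1} → B′_m → B′_{m−1}` is exact
at `B′_m`: every element of `B′_m` killed by `∂` lies in `∂ (B′_{m+1})`. -/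
theorem genus1_subcomplex_exact (g : ℕ) (hg : 2 ≤ g) :
    (∀ m : ℕ, 1 ≤ m → ∀ x ∈ genusSubgroup1 g (m + 1), permBdry m x ∈ genusSubgroup1 g m) ∧
    (∀ k : ℕ, k + 2 ≤ g → ∀ x ∈ genusSubgroup1 g (k + 2),
      permBdry (k + 1) x = 0 → ∃ y ∈ genusSubgroup1 g (k + 3), permBdry (k + 2) y = x) := by
  exact ⟨fun m _ x hx => permBdry_mem_genusSubgroup1 g m hx, fun k hk x _ hx =>
    ⟨permTopMap (k + 2) x, permTopMap_mem_genusSubgroup1 hk x, by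
      simp [permBdry_permTopMap, hx]⟩⟩
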